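/- Let β be a positive even integer and fix x ∈ ℝ. With w, J_N(x) and I(x) as follows: w(u₁,…,u_β) := ∏_{j=1}^β u_j^{2/β − 1}(1 − u_j)^{2/β − 1} · ∏_{1≤j<k≤β} |u_k − u_j|^{4/β} on (0,1)^β; J_N(x) := ∫_{[0,1]^β} ∏_{j=1}^β (1 − (1 − e^{2πix/N})u_j)^{N−2} · w(u) du; I(x) := ∫_{[0,1]^β} ∏_{j=1}^β e^{2πix·u_j} · w(u) du. Then lim_{N→∞} N·( J_N(x) − I(x) ) = −2πiβx · I(x). -/

import Mathlib

open MeasureTheory Real Filter Topology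

/-- The Selberg-type weight
`w(u) = ∏_j u_j^{2/β−1}(1−u_j)^{2/β−1} ∏_{j<k} |u_k−u_j|^{4/β}`. -/
noncomputable def selbergW (β : ℕ) (u : Fin β → ℝ) : ℝ :=
  (∏ j : Fin β, u j ^ ((2 : ℝ) / β - 1) * (1 - u j) ^ ((2 : ℝ) / β - 1)) *
    ∏ j : Fin β, ∏ k ∈ Finset.Ioi j, |u k - u j| ^ ((4 : ℝ) / β)

/-- The β-dimensional integral `J_N(x)` representing (up to explicit prefactors) the
bulk-scaled two-point correlation of the circular β-ensemble with β even. -/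
noncomputable def JN (β : ℕ) (N : ℕ) (x : ℝ) : ℂ :=
  ∫ u in Set.univ.pi fun _ : Fin β => Set.Icc (0 : ℝ) 1,
    (∏ j : Fin β,
        (1 - (1 - Complex.exp (2 * (π : ℂ) * Complex.I * (x : ℂ) / (N : ℂ))) * (u j : ℂ))
          ^ (N - 2)) *
      (selbergW β u : ℂ)

/-- The limiting β-dimensional integral `I(x)`. -/
noncomputable def Ilim (β : ℕ) (x : ℝ) : ℂ :=
  ∫ u in Set.univ.pi fun _ : Fin β => Set.Icc (0 : ℝ) 1,
    (∏ j : Fin β, Complex.exp (2 * (π : ℂ) * Complex.I * (x : ℂ) * (u j : ℂ))) *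
      (selbergW β u : ℂ)


lemma lim_of_hasDerivAt {f : ℂ → ℂ} {f' x κ : ℂ} (hf : HasDerivAt f f' x) {c z : ℕ → ℂ}
    (hc : Tendsto (fun n => ‖c n‖) atTop atTop)
    (hz : Tendsto (fun n => c n * z n) atTop (𝓝 κ)) :
    Tendsto (fun n => c n * (f (x + z n) - f x)) atTop (𝓝 (f' * κ)) := by
  have hci : Tendsto (fun n => (c n)⁻¹) atTop (𝓝 0) :=
    tendsto_inv₀_cobounded.comp (tendsto_norm_atTop_iff_cobounded.mp hc)
  have hc0 : ∀ᶠ n in atTop, c n ≠ 0 := by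
    filter_upwards [hc.eventually_gt_atTop 0] with n hn
    exact norm_pos_iff.mp hn
  have hz0 : Tendsto z atTop (𝓝 0) := by
    have := hci.mul hz
    rw [zero_mul] at this
    refine this.congr' ?_
    filter_upwards [hc0] with n hn
    field_simp
  have ho := hf.isLittleO
  have hxz : Tendsto (fun n => x + z n) atTop (𝓝 x) := by
    simpa using hz0.const_add x
  have h1 := ho.comp_tendsto hxz
  have h2 : (fun n => c n * (f (x + z n) - f x - z n * f')) =o[atTop] (fun n => c n * z n) := by
    have := (Asymptotics.isBigO_refl c atTop).mul_isLittleO h1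
    simpa [Function.comp_def] using this
  have h3 : Tendsto (fun n => c n * (f (x + z n) - f x - z n * f')) atTop (𝓝 0) :=
    (Asymptotics.isLittleO_one_iff ℂ).mp (h2.trans_isBigO (hz.isBigO_one ℂ))
  have := h3.add (hz.mul_const f')
  rw [zero_add, mul_comm κ] at this
  refine this.congr fun n => by ring

lemma natC_atTop : Tendsto (fun n : ℕ => ‖(n : ℂ)‖) atTop atTop := by
  simpa using tendsto_natCast_atTop_atTop (R := ℝ)

lemma prod_sub_prod_le {ι : Type*} (s : Finset ι) (a b : ι → ℂ) (ha : ∀ i ∈ s, ‖a i‖ ≤ 1)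
    (hb : ∀ i ∈ s, ‖b i‖ ≤ 1) (δ : ℝ) (h : ∀ i ∈ s, ‖a i - b i‖ ≤ δ) :
    ‖∏ i ∈ s, a i - ∏ i ∈ s, b i‖ ≤ s.card * δ := by
  classical
  induction s using Finset.induction_on with
  | empty => simp
  | insert i s hi ih =>
    rw [Finset.prod_insert hi, Finset.prod_insert hi, Finset.card_insert_of_notMem hi]
    have e : a i * ∏ i ∈ s, a i - b i * ∏ i ∈ s, b i
      = (a i - b i) * ∏ i ∈ s, a i + b i * (∏ i ∈ s, a i - ∏ i ∈ s, b i) := by ring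
    rw [e]
    refine (norm_add_le _ _).trans ?_
    rw [norm_mul, norm_mul]
    have i1 := ih (fun j hj => ha j (by simp [hj])) (fun j hj => hb j (by simp [hj]))
      (fun j hj => h j (by simp [hj]))
    have i2 : ‖∏ i ∈ s, a i‖ ≤ 1 := by
      rw [norm_prod]
      exact Finset.prod_le_one (fun _ _ => norm_nonneg _) (fun j hj => ha j (by simp [hj]))
    have i3 := h i (by simp)
    have i4 := hb i (by simp)
    have j1 := mul_le_mul i3 i2 (norm_nonneg _) ((norm_nonneg _).trans i3)
    have j2 := mul_le_mul i4 i1 (norm_nonneg _) zero_le_one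
    push_cast
    linarith

lemma prod_lim {ι : Type*} (s : Finset ι) (a : ℕ → ι → ℂ) (b c : ι → ℂ)
    (h : ∀ i ∈ s, Tendsto (fun N : ℕ => (N : ℂ) * (a N i - b i)) atTop (𝓝 (b i * c i)))
    (h0 : ∀ i ∈ s, Tendsto (fun N : ℕ => a N i) atTop (𝓝 (b i))) :
    Tendsto (fun N : ℕ => (N : ℂ) * (∏ i ∈ s, a N i - ∏ i ∈ s, b i)) atTop
      (𝓝 ((∏ i ∈ s, b i) * ∑ i ∈ s, c i)) := by
  classical
  induction s using Finset.induction_on with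
  | empty => simp
  | insert i s hi ih =>
    have i1 := ih (fun j hj => h j (by simp [hj])) (fun j hj => h0 j (by simp [hj]))
    have i2 : Tendsto (fun N : ℕ => ∏ i ∈ s, a N i) atTop (𝓝 (∏ i ∈ s, b i)) :=
      tendsto_finsetProd _ (fun j hj => h0 j (by simp [hj]))
    have := ((h i (by simp)).mul i2).add (i1.const_mul (b i))
    simp_rw [Finset.prod_insert hi, Finset.sum_insert hi]
    convert this using 2 <;> ring

lemma sum_lim_of_bound {a : ℕ → ℂ} {b : ℂ} {C : ℝ}
    (h : ∀ᶠ N : ℕ in atTop, ‖a N - b‖ ≤ C / N) : Tendsto a atTop (𝓝 b) := by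
  rw [tendsto_iff_norm_sub_tendsto_zero]
  exact squeeze_zero' (Eventually.of_forall fun _ => norm_nonneg _) h
    (tendsto_const_div_atTop_nhds_zero_nat C)

abbrev cube (β : ℕ) : Set (Fin β → ℝ) := Set.univ.pi fun _ : Fin β => Set.Icc (0 : ℝ) 1

lemma master (β : ℕ) (w : (Fin β → ℝ) → ℝ) (hw : IntegrableOn w (cube β))
    (a : ℕ → ℝ → ℂ) (b c : ℝ → ℂ) (ham : ∀ N, Measurable (a N)) (hbm : Measurable b) (C : ℝ)
    (ha : ∀ᶠ N : ℕ in atTop, ∀ u ∈ Set.Icc (0 : ℝ) 1, ‖a N u‖ ≤ 1)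
    (hb : ∀ u ∈ Set.Icc (0 : ℝ) 1, ‖b u‖ ≤ 1)
    (hab : ∀ᶠ N : ℕ in atTop, ∀ u ∈ Set.Icc (0 : ℝ) 1, ‖a N u - b u‖ ≤ C / N)
    (hl : ∀ u ∈ Set.Icc (0 : ℝ) 1,
      Tendsto (fun N : ℕ => (N : ℂ) * (a N u - b u)) atTop (𝓝 (b u * c u))) :
    Tendsto (fun N : ℕ => (N : ℂ) * ((∫ u in cube β, (∏ j, a N (u j)) * (w u : ℂ))
      - ∫ u in cube β, (∏ j, b (u j)) * (w u : ℂ))) atTop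
      (𝓝 (∫ u in cube β, ((∏ j, b (u j)) * ∑ j, c (u j)) * (w u : ℂ))) := by
  have hcm : MeasurableSet (cube β) := MeasurableSet.univ_pi fun _ => measurableSet_Icc
  have hwc : IntegrableOn (fun u => (w u : ℂ)) (cube β) := hw.ofReal
  have hmem : ∀ u ∈ cube β, ∀ j, u j ∈ Set.Icc (0 : ℝ) 1 := fun u hu j => hu j (Set.mem_univ j)
  have int : ∀ f : ℝ → ℂ, Measurable f → (∀ u ∈ Set.Icc (0 : ℝ) 1, ‖f u‖ ≤ 1) →
      IntegrableOn (fun u : Fin β → ℝ => (∏ j, f (u j)) * (w u : ℂ)) (cube β) := by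
    intro f hf hf1
    refine Integrable.bdd_mul (c := 1) hwc ?_ ?_
    · exact (Finset.measurable_prod _
        fun j _ => hf.comp (measurable_pi_apply j)).aestronglyMeasurable
    · filter_upwards [ae_restrict_mem hcm] with u hu
      rw [norm_prod]
      exact Finset.prod_le_one (fun _ _ => norm_nonneg _) (fun j _ => hf1 _ (hmem u hu j))
  have key : Tendsto (fun N : ℕ => ∫ u in cube β,
      (N : ℂ) * (∏ j, a N (u j) - ∏ j, b (u j)) * (w u : ℂ)) atTop
      (𝓝 (∫ u in cube β, ((∏ j, b (u j)) * ∑ j, c (u j)) * (w u : ℂ))) := by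
    refine tendsto_integral_filter_of_dominated_convergence (fun u => (β * C) * ‖w u‖) ?_ ?_ ?_ ?_
    · refine Eventually.of_forall fun N => ?_
      refine AEStronglyMeasurable.mul ?_ hwc.aestronglyMeasurable
      refine Measurable.aestronglyMeasurable ?_
      refine Measurable.const_mul (Measurable.sub ?_ ?_) _
      · exact Finset.measurable_prod _ fun j _ => (ham N).comp (measurable_pi_apply j)
      · exact Finset.measurable_prod _ fun j _ => hbm.comp (measurable_pi_apply j)
    · filter_upwards [ha, hab, eventually_gt_atTop 0] with N h1 h2 hN
      filter_upwards [ae_restrict_mem hcm] with u hu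
      have := prod_sub_prod_le Finset.univ (fun j => a N (u j)) (fun j => b (u j))
        (fun j _ => h1 _ (hmem u hu j)) (fun j _ => hb _ (hmem u hu j)) _
        (fun j _ => h2 _ (hmem u hu j))
      rw [Finset.card_univ, Fintype.card_fin] at this
      rw [norm_mul, norm_mul, Complex.norm_real, Complex.norm_natCast]
      refine mul_le_mul_of_nonneg_right ?_ (norm_nonneg _)
      have hN' : (0 : ℝ) < N := by exact_mod_cast hN
      calc (N : ℝ) * _ ≤ N * (β * (C / N)) := mul_le_mul_of_nonneg_left this hN'.le
        _ = β * C := by field_simp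
    · exact (hw.norm).const_mul _
    · filter_upwards [ae_restrict_mem hcm] with u hu
      refine Tendsto.mul_const _ ?_
      refine prod_lim Finset.univ (fun N j => a N (u j)) _ _ (fun j _ => hl _ (hmem u hu j)) ?_
      intro j _
      refine sum_lim_of_bound (C := C) ?_
      filter_upwards [hab] with N h using h _ (hmem u hu j)
  refine key.congr' ?_
  filter_upwards [ha] with N h1
  rw [← integral_sub (int _ (ham N) h1) (int _ hbm hb), ← integral_const_mul]
  congr 1
  ext u
  ring

lemma exp_second {z : ℂ} :
    Tendsto (fun N : ℕ => (N : ℂ) ^ 2 * (Complex.exp (z / N) - 1 - z / N)) atTop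
      (𝓝 (z ^ 2 / 2)) := by
  rw [tendsto_iff_norm_sub_tendsto_zero]
  refine squeeze_zero' (g := fun N : ℕ => (‖z‖ ^ 3 * Real.exp ‖z‖) / N)
    (Eventually.of_forall fun _ => norm_nonneg _) ?_
    (tendsto_const_div_atTop_nhds_zero_nat _)
  filter_upwards [eventually_gt_atTop 0] with N hN
  have hN' : (0 : ℝ) < N := by exact_mod_cast hN
  have hNc : (N : ℂ) ≠ 0 := by exact_mod_cast hN.ne'
  have h := Complex.norm_exp_sub_sum_le_norm_mul_exp (z / N) 3
  simp only [Finset.sum_range_succ, Finset.sum_range_zero] at h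
  have e : (N : ℂ) ^ 2 * (Complex.exp (z / N) - 1 - z / N) - z ^ 2 / 2
    = (N : ℂ) ^ 2 * (Complex.exp (z / N) - (0 + (z / N) ^ 0 / (Nat.factorial 0 : ℂ)
      + (z / N) ^ 1 / (Nat.factorial 1 : ℂ) + (z / N) ^ 2 / (Nat.factorial 2 : ℂ))) := by
    simp [Nat.factorial]
    field_simp
    ring
  rw [e, norm_mul, norm_pow, Complex.norm_natCast]
  have h2 : ‖z / N‖ = ‖z‖ / N := by rw [norm_div, Complex.norm_natCast]
  rw [h2] at h
  have h3 : ‖z‖ / N ≤ ‖z‖ := div_le_self (norm_nonneg _) (by exact_mod_cast hN)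
  calc _ ≤ (N : ℝ) ^ 2 * ((‖z‖ / N) ^ 3 * Real.exp (‖z‖ / N)) :=
        mul_le_mul_of_nonneg_left h (by positivity)
    _ ≤ (N : ℝ) ^ 2 * ((‖z‖ / N) ^ 3 * Real.exp ‖z‖) := by gcongr
    _ = _ := by field_simp

noncomputable def aJ (θ : ℝ) (N : ℕ) (u : ℝ) : ℂ :=
  (1 - (1 - Complex.exp (Complex.I * θ / N)) * (u : ℂ)) ^ (N - 2)

noncomputable def bI (θ : ℝ) (u : ℝ) : ℂ := Complex.exp (Complex.I * θ * u)

lemma bI_norm (θ u : ℝ) : ‖bI θ u‖ = 1 := by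
  have : Complex.I * θ * u = ((θ * u : ℝ) : ℂ) * Complex.I := by push_cast; ring
  rw [bI, this, Complex.norm_exp_ofReal_mul_I]

lemma g_norm (θ : ℝ) (N : ℕ) (u : ℝ) (hu : u ∈ Set.Icc (0 : ℝ) 1) :
    ‖1 - (1 - Complex.exp (Complex.I * θ / N)) * (u : ℂ)‖ ≤ 1 := by
  have e : 1 - (1 - Complex.exp (Complex.I * θ / N)) * (u : ℂ)
    = ((1 - u : ℝ) : ℂ) + (u : ℂ) * Complex.exp (((θ / N : ℝ) : ℂ) * Complex.I) := by
    have : Complex.I * θ / N = ((θ / N : ℝ) : ℂ) * Complex.I := by push_cast; ring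
    rw [this]; push_cast; ring
  rw [e]
  refine (norm_add_le _ _).trans ?_
  rw [norm_mul, Complex.norm_exp_ofReal_mul_I, Complex.norm_real, Complex.norm_real,
    Real.norm_of_nonneg hu.1, Real.norm_of_nonneg (by linarith [hu.2])]
  linarith

lemma aJ_norm (θ : ℝ) (N : ℕ) (u : ℝ) (hu : u ∈ Set.Icc (0 : ℝ) 1) : ‖aJ θ N u‖ ≤ 1 := by
  rw [aJ, norm_pow]
  exact pow_le_one₀ (norm_nonneg _) (g_norm θ N u hu)

lemma h_pow (θ u : ℝ) (N : ℕ) (hN : 2 ≤ N) :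
    Complex.exp (Complex.I * θ * u / N) ^ (N - 2)
      = Complex.exp (Complex.I * θ * u + -(2 * (Complex.I * θ * u)) / N) := by
  have hNc : (N : ℂ) ≠ 0 := by
    have : N ≠ 0 := by omega
    exact_mod_cast this
  rw [← Complex.exp_nat_mul]
  congr 1
  push_cast [hN]
  field_simp
  ring

lemma aJ_bound (θ : ℝ) (N : ℕ) (hN : 2 ≤ N) (hθ : |θ| ≤ N) (u : ℝ)
    (hu : u ∈ Set.Icc (0 : ℝ) 1) : ‖aJ θ N u - bI θ u‖ ≤ (2 * θ ^ 2 + 2 * |θ|) / N := by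
  have hN' : (0 : ℝ) < N := by
    have : 0 < N := by omega
    exact_mod_cast this
  set g := 1 - (1 - Complex.exp (Complex.I * θ / N)) * (u : ℂ) with hg
  set h := Complex.exp (Complex.I * θ * u / N) with hh
  have hhn : ‖h‖ = 1 := by
    have : Complex.I * θ * u / N = ((θ * u / N : ℝ) : ℂ) * Complex.I := by push_cast; ring
    rw [hh, this, Complex.norm_exp_ofReal_mul_I]
  have n1 : ‖Complex.I * θ / N‖ = |θ| / N := by simp
  have n2 : ‖Complex.I * θ * u / N‖ = |θ| * u / N := by simp [abs_of_nonneg hu.1]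
  have le1 : |θ| / N ≤ 1 := (div_le_one hN').mpr hθ
  have le2 : |θ| * u / N ≤ |θ| / N := by
    gcongr
    exact mul_le_of_le_one_right (abs_nonneg _) hu.2
  have E1 := Complex.norm_exp_sub_one_sub_id_le (x := Complex.I * θ / N) (by rw [n1]; exact le1)
  have E2 := Complex.norm_exp_sub_one_sub_id_le (x := Complex.I * θ * u / N)
    (by rw [n2]; linarith)
  rw [n1] at E1
  rw [n2] at E2
  have E3 : (|θ| * u / N) ^ 2 ≤ (|θ| / N) ^ 2 := by
    have := hu.1
    gcongr
  have gh : ‖g - h‖ ≤ 2 * (|θ| / N) ^ 2 := by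
    have e : g - h = (u : ℂ) * (Complex.exp (Complex.I * θ / N) - 1 - Complex.I * θ / N)
      - (h - 1 - Complex.I * θ * u / N) := by rw [hg]; ring
    rw [e]
    refine (norm_sub_le _ _).trans ?_
    rw [norm_mul, Complex.norm_real, Real.norm_of_nonneg hu.1]
    have : u * ‖Complex.exp (Complex.I * θ / N) - 1 - Complex.I * θ / N‖ ≤ 1 * (|θ| / N) ^ 2 :=
      mul_le_mul hu.2 E1 (norm_nonneg _) zero_le_one
    linarith
  have p1 := prod_sub_prod_le (Finset.range (N - 2)) (fun _ => g) (fun _ => h)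
    (fun _ _ => g_norm θ N u hu) (fun _ _ => hhn.le) _ (fun _ _ => gh)
  simp only [Finset.prod_const, Finset.card_range] at p1
  have p2 : ‖h ^ (N - 2) - bI θ u‖ ≤ 2 * |θ| / N := by
    rw [hh, h_pow θ u N hN, Complex.exp_add]
    have e : Complex.exp (Complex.I * θ * u) * Complex.exp (-(2 * (Complex.I * θ * u)) / N) - bI θ u
      = bI θ u * (Complex.exp (Complex.I * ((-(2 * θ * u) / N : ℝ) : ℂ)) - 1) := by
      rw [bI, mul_sub, mul_one]
      congr 3
      push_cast; ring
    rw [e, norm_mul, bI_norm, one_mul]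
    refine (Real.norm_exp_I_mul_ofReal_sub_one_le).trans ?_
    rw [Real.norm_eq_abs, abs_div, abs_neg, abs_mul, abs_mul, abs_of_nonneg hu.1, Nat.abs_cast,
      abs_two]
    exact div_le_div_of_nonneg_right (mul_le_of_le_one_right (by positivity) hu.2) hN'.le
  have p3 : ((N - 2 : ℕ) : ℝ) * (2 * (|θ| / N) ^ 2) ≤ N * (2 * (|θ| / N) ^ 2) := by
    gcongr
    omega
  have p4 : N * (2 * (|θ| / N) ^ 2) = 2 * θ ^ 2 / N := by
    rw [div_pow, sq_abs]; field_simp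
  have e : aJ θ N u - bI θ u = (g ^ (N - 2) - h ^ (N - 2)) + (h ^ (N - 2) - bI θ u) := by
    rw [aJ]; ring
  rw [e, add_div]
  refine (norm_add_le _ _).trans ?_
  linarith

lemma aJ_lim (θ u : ℝ) :
    Tendsto (fun N : ℕ => (N : ℂ) * (aJ θ N u - bI θ u)) atTop
      (𝓝 (bI θ u * (Complex.I * θ / 2 * (-4 * u + Complex.I * θ * (u * (1 - u)))))) := by
  set T : ℂ := Complex.I * θ with hT
  set κ : ℂ := (u : ℂ) * (T ^ 2 / 2) - (T * u) ^ 2 / 2 with hκ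
  set r : ℕ → ℂ := fun N => (1 - (1 - Complex.exp (T / N)) * (u : ℂ)) / Complex.exp (T * u / N) - 1
    with hr
  have hinv : Tendsto (fun N : ℕ => (N : ℂ)⁻¹) atTop (𝓝 0) :=
    tendsto_inv₀_cobounded.comp (tendsto_norm_atTop_iff_cobounded.mp natC_atTop)
  have hh : Tendsto (fun N : ℕ => Complex.exp (T * u / N)) atTop (𝓝 1) := by
    have h0 : Tendsto (fun N : ℕ => T * u / N) atTop (𝓝 0) := by
      simpa [div_eq_mul_inv] using hinv.const_mul (T * u)
    simpa [Function.comp_def] using (Complex.continuous_exp.tendsto 0).comp h0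
  have hr2 : Tendsto (fun N : ℕ => (N : ℂ) ^ 2 * r N) atTop (𝓝 κ) := by
    have h1 := (((exp_second (z := T)).const_mul (u : ℂ)).sub (exp_second (z := T * u))).div hh
      one_ne_zero
    rw [div_one] at h1
    refine h1.congr fun N => ?_
    have := Complex.exp_ne_zero (T * u / N)
    simp only [hr, Pi.div_apply]
    generalize Complex.exp (T * u / N) = h at *
    field_simp
    ring
  have hsq : Tendsto (fun n : ℕ => ‖(n : ℂ) ^ 2‖) atTop atTop := by
    simp_rw [norm_pow]
    exact (tendsto_pow_atTop two_ne_zero).comp natC_atTop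
  have hlog : Tendsto (fun N : ℕ => (N : ℂ) ^ 2 * Complex.log (1 + r N)) atTop (𝓝 κ) := by
    have := lim_of_hasDerivAt (Complex.hasDerivAt_log (z := 1) (by simp)) hsq hr2
    simpa using this
  have hr0 : Tendsto r atTop (𝓝 0) := by
    have := (hinv.pow 2).mul hr2
    simp only [ne_eq, OfNat.ofNat_ne_zero, not_false_eq_true, zero_pow, zero_mul] at this
    refine this.congr' ?_
    filter_upwards [eventually_gt_atTop 0] with N hN
    have hNc : (N : ℂ) ≠ 0 := by exact_mod_cast hN.ne'
    field_simp
  have hz : Tendsto (fun N : ℕ => (N : ℂ) * (-(2 * (T * u)) / N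
      + ((N - 2 : ℕ) : ℂ) * Complex.log (1 + r N))) atTop (𝓝 (-(2 * (T * u)) + κ)) := by
    have h1 := (hlog.sub ((hinv.mul hlog).const_mul 2)).const_add (-(2 * (T * u)))
    simp only [zero_mul, mul_zero, sub_zero] at h1
    refine h1.congr' ?_
    filter_upwards [eventually_ge_atTop 2] with N hN
    have hNc : (N : ℂ) ≠ 0 := by
      have : N ≠ 0 := by omega
      exact_mod_cast this
    push_cast [hN]
    field_simp
  have hfin := lim_of_hasDerivAt (Complex.hasDerivAt_exp (T * u)) natC_atTop hz
  have e : bI θ u * (T / 2 * (-4 * u + T * (u * (1 - u))))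
    = Complex.exp (T * u) * (-(2 * (T * u)) + κ) := by
    rw [bI, hκ, ← hT]; ring
  rw [e]
  refine hfin.congr' ?_
  have hne : ∀ᶠ N in atTop, 1 + r N ≠ 0 := by
    have : Tendsto (fun N => 1 + r N) atTop (𝓝 1) := by simpa using hr0.const_add 1
    exact this.eventually_ne one_ne_zero
  filter_upwards [eventually_ge_atTop 2, hne] with N hN h1
  rw [← add_assoc, Complex.exp_add, ← h_pow θ u N hN, Complex.exp_nat_mul, Complex.exp_log h1,
    ← mul_pow, bI, aJ]
  congr 3
  simp only [hr, ← hT]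
  rw [add_sub_cancel, mul_div_cancel₀ _ (Complex.exp_ne_zero _)]

/-! second family -/

noncomputable def kI (θ : ℝ) (N : ℕ) (u : ℝ) : ℂ :=
  ((((1 + u / N) ^ 4)⁻¹ : ℝ) : ℂ) * bI θ ((1 + 1 / N) * u / (1 + u / N))

lemma kI_norm (θ : ℝ) (N : ℕ) (u : ℝ) (hu : u ∈ Set.Icc (0 : ℝ) 1) : ‖kI θ N u‖ ≤ 1 := by
  have h : (0 : ℝ) ≤ u / N := div_nonneg hu.1 (Nat.cast_nonneg _)
  rw [kI, norm_mul, bI_norm, mul_one, Complex.norm_real, Real.norm_of_nonneg (by positivity)]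
  exact inv_le_one_of_one_le₀ (one_le_pow₀ (by linarith))

lemma bI_sub (θ u v : ℝ) : ‖bI θ u - bI θ v‖ ≤ |θ| * |u - v| := by
  have e : bI θ u - bI θ v = bI θ v * (Complex.exp (Complex.I * ((θ * (u - v) : ℝ) : ℂ)) - 1) := by
    rw [mul_sub, mul_one, bI, bI, ← Complex.exp_add]
    congr 2
    push_cast; ring
  rw [e, norm_mul, bI_norm, one_mul]
  refine (Real.norm_exp_I_mul_ofReal_sub_one_le).trans ?_
  rw [Real.norm_eq_abs, abs_mul]

lemma kI_bound (θ : ℝ) (N : ℕ) (hN : 1 ≤ N) (u : ℝ)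
    (hu : u ∈ Set.Icc (0 : ℝ) 1) : ‖kI θ N u - bI θ u‖ ≤ (4 + |θ|) / N := by
  have hN' : (0 : ℝ) < N := by exact_mod_cast hN
  have hN1 : (1 : ℝ) ≤ N := by exact_mod_cast hN
  have h : (0 : ℝ) ≤ u / N := div_nonneg hu.1 (Nat.cast_nonneg _)
  have h' : u / N ≤ 1 / N := by gcongr; exact hu.2
  set D : ℝ := 1 + u / N with hD
  have hD1 : 1 ≤ D := by linarith
  have hD0 : 0 < D := by linarith
  have e : kI θ N u - bI θ u = (((D ^ 4)⁻¹ - 1 : ℝ) : ℂ) * bI θ ((1 + 1 / N) * u / D)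
    + (bI θ ((1 + 1 / N) * u / D) - bI θ u) := by
    rw [kI, ← hD]; push_cast; ring
  have p1 : |(D ^ 4)⁻¹ - 1| ≤ 4 / N := by
    have i1 : (D ^ 4)⁻¹ ≤ 1 := inv_le_one_of_one_le₀ (one_le_pow₀ hD1)
    rw [abs_of_nonpos (by linarith)]
    have i2 : 1 - 1 / N ≤ D⁻¹ := by
      have : 1 - u / N ≤ D⁻¹ := by
        rw [← one_div, le_div_iff₀ hD0, hD]
        nlinarith
      linarith
    have i3 := one_add_mul_le_pow (a := D⁻¹ - 1) (by have : 0 < D⁻¹ := by positivity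
                                                     linarith) 4
    rw [add_sub_cancel, inv_pow] at i3
    push_cast at i3
    have : (4 : ℝ) / N = 4 * (1 / N) := by ring
    linarith
  have p2 : |(1 + 1 / N) * u / D - u| ≤ 1 / N := by
    have e2 : (1 + 1 / N) * u / D - u = (1 / N) * (u * (1 - u) / D) := by
      rw [eq_comm]
      field_simp
      rw [hD]
      field_simp
      ring
    have : 0 ≤ u * (1 - u) := mul_nonneg hu.1 (by linarith [hu.2])
    rw [e2, abs_of_nonneg (by positivity)]
    refine mul_le_of_le_one_right (by positivity) ?_
    rw [div_le_one hD0]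
    nlinarith [hu.1, hu.2]
  rw [e]
  refine (norm_add_le _ _).trans ?_
  rw [norm_mul, bI_norm, mul_one, Complex.norm_real, Real.norm_eq_abs, add_div]
  have p3 := bI_sub θ ((1 + 1 / N) * u / D) u
  have p4 : |θ| * |(1 + 1 / N) * u / D - u| ≤ |θ| * (1 / N) := by gcongr
  have : |θ| / N = |θ| * (1 / N) := by ring
  linarith

lemma kI_lim (θ u : ℝ) :
    Tendsto (fun N : ℕ => (N : ℂ) * (kI θ N u - bI θ u)) atTop
      (𝓝 (bI θ u * ((-4 * u + Complex.I * θ * (u * (1 - u)))))) := by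
  set f : ℂ → ℂ := fun ε => ((1 + u * ε) ^ 4)⁻¹ *
    Complex.exp (Complex.I * θ * ((1 + ε) * u / (1 + u * ε))) with hf
  have d1 : HasDerivAt (fun ε : ℂ => 1 + (u : ℂ) * ε) u 0 := by
    simpa using ((hasDerivAt_id (0 : ℂ)).const_mul (u : ℂ)).const_add 1
  have d2 : HasDerivAt (fun ε : ℂ => (1 + ε) * (u : ℂ)) u 0 := by
    simpa using ((hasDerivAt_id (0 : ℂ)).const_add 1).mul_const (u : ℂ)
  have d3 := ((d1.pow 4).inv (by simp)).mul (((d2.div d1 (by simp)).const_mul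
    (Complex.I * θ)).cexp)
  have d4 : HasDerivAt f (bI θ u * ((-4 * u + Complex.I * θ * (u * (1 - u))))) 0 := by
    refine d3.congr_deriv ?_
    simp [bI]
    ring
  have hz : Tendsto (fun N : ℕ => (N : ℂ) * (N : ℂ)⁻¹) atTop (𝓝 1) := by
    refine tendsto_const_nhds.congr' ?_
    filter_upwards [eventually_gt_atTop 0] with N hN
    have hNc : (N : ℂ) ≠ 0 := by exact_mod_cast hN.ne'
    field_simp
  have := lim_of_hasDerivAt d4 natC_atTop hz
  rw [mul_one] at this
  refine this.congr fun N => ?_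
  simp only [hf, kI, bI]
  push_cast
  simp [div_eq_mul_inv]

lemma pair_prod (β : ℕ) (f : Fin β → ℝ) :
    ∏ j : Fin β, ∏ k ∈ Finset.Ioi j, (f k * f j) = ∏ j, f j ^ (β - 1) := by
  have h1 : ∏ j : Fin β, ∏ k ∈ Finset.Ioi j, f k = ∏ k : Fin β, ∏ j ∈ Finset.Iio k, f k := by
    refine Finset.prod_comm' ?_
    simp
  simp_rw [Finset.prod_mul_distrib]
  rw [h1, ← Finset.prod_mul_distrib]
  refine Finset.prod_congr rfl fun j _ => ?_
  rw [Finset.prod_const, Finset.prod_const, ← pow_add, Fin.card_Iio, Fin.card_Ioi]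
  congr 1
  have := j.2
  omega

lemma beta_int {a : ℝ} (ha : -1 < a) :
    IntegrableOn (fun u : ℝ => u ^ a * (1 - u) ^ a) (Set.Icc 0 1) := by
  have h := Complex.betaIntegral_convergent (u := ((a + 1 : ℝ) : ℂ)) (v := ((a + 1 : ℝ) : ℂ))
    (by simp; linarith) (by simp; linarith)
  rw [intervalIntegrable_iff_integrableOn_Ioc_of_le zero_le_one] at h
  rw [integrableOn_Icc_iff_integrableOn_Ioc]
  refine (integrableOn_congr_fun ?_ measurableSet_Ioc).mp h.norm
  intro u hu
  have h1 : ((a + 1 : ℝ) : ℂ) - 1 = (a : ℂ) := by push_cast; ring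
  have h2 : (1 : ℂ) - u = ((1 - u : ℝ) : ℂ) := by push_cast; ring
  have h3 : 0 ≤ 1 - u := by linarith [hu.2]
  simp only [h1, h2]
  rw [← Complex.ofReal_cpow hu.1.le, ← Complex.ofReal_cpow h3, ← Complex.ofReal_mul,
    Complex.norm_real, Real.norm_of_nonneg]
  exact mul_nonneg (Real.rpow_nonneg hu.1.le _) (Real.rpow_nonneg h3 _)

lemma selbergW_int (β : ℕ) (hβ : 0 < β) : IntegrableOn (selbergW β) (cube β) := by
  have hcm : MeasurableSet (cube β) := MeasurableSet.univ_pi fun _ => measurableSet_Icc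
  have hβ' : (0 : ℝ) < β := by exact_mod_cast hβ
  have h1 : IntegrableOn (fun u : Fin β → ℝ =>
      ∏ j : Fin β, u j ^ ((2 : ℝ) / β - 1) * (1 - u j) ^ ((2 : ℝ) / β - 1)) (cube β) := by
    unfold IntegrableOn cube
    rw [volume_pi, Measure.restrict_pi_pi]
    refine Integrable.fintype_prod
      (f := fun _ (u : ℝ) => u ^ ((2 : ℝ) / β - 1) * (1 - u) ^ ((2 : ℝ) / β - 1)) fun _ => ?_
    have : (0 : ℝ) < 2 / β := by positivity
    exact beta_int (by linarith)
  unfold selbergW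
  refine Integrable.mul_bdd (c := 1) h1 ?_ ?_
  · refine Measurable.aestronglyMeasurable ?_
    refine Finset.measurable_prod _ fun j _ => Finset.measurable_prod _ fun k _ => ?_
    fun_prop
  · filter_upwards [ae_restrict_mem hcm] with u hu
    have hmem : ∀ j, u j ∈ Set.Icc (0 : ℝ) 1 := fun j => hu j (Set.mem_univ j)
    rw [norm_prod]
    refine Finset.prod_le_one (fun _ _ => norm_nonneg _) fun j _ => ?_
    rw [norm_prod]
    refine Finset.prod_le_one (fun _ _ => norm_nonneg _) fun k _ => ?_
    rw [Real.norm_of_nonneg (by positivity)]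
    refine Real.rpow_le_one (abs_nonneg _) ?_ (by positivity)
    rw [abs_le]
    constructor <;> linarith [(hmem j).1, (hmem j).2, (hmem k).1, (hmem k).2]

/-- The projective map of the unit interval. -/
noncomputable def phi (ε u : ℝ) : ℝ := (1 + ε) * u / (1 + ε * u)

lemma selbergW_phi (β : ℕ) (hβ : 0 < β) (ε : ℝ) (hε : 0 < ε) (u : Fin β → ℝ) (hu : u ∈ cube β) :
    (∏ j, (1 + ε) / (1 + ε * u j) ^ 2) * selbergW β (fun j => phi ε (u j))
      = (1 + ε) ^ (2 * β) * (∏ j, ((1 + ε * u j) ^ 4)⁻¹) * selbergW β u := by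
  have hβ' : (0 : ℝ) < β := by exact_mod_cast hβ
  have hmem : ∀ j, u j ∈ Set.Icc (0 : ℝ) 1 := fun j => hu j (Set.mem_univ j)
  have hs : 0 < 1 + ε := by linarith
  have hD : ∀ j, 0 < 1 + ε * u j := fun j => by
    have := mul_nonneg hε.le (hmem j).1
    linarith
  set a : ℝ := (2 : ℝ) / β - 1 with ha
  set b : ℝ := (4 : ℝ) / β with hb
  have A : ∀ j, phi ε (u j) ^ a * (1 - phi ε (u j)) ^ a
      = ((1 + ε) ^ a * ((1 + ε * u j) ^ a)⁻¹ * ((1 + ε * u j) ^ a)⁻¹) *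
        (u j ^ a * (1 - u j) ^ a) := by
    intro j
    have h1 : 1 - phi ε (u j) = (1 - u j) / (1 + ε * u j) := by
      unfold phi
      have := (hD j).ne'
      field_simp
      ring
    have h3 : 0 ≤ 1 - u j := by linarith [(hmem j).2]
    rw [h1, phi, Real.div_rpow (mul_nonneg hs.le (hmem j).1) (hD j).le,
      Real.div_rpow h3 (hD j).le, Real.mul_rpow hs.le (hmem j).1]
    ring
  set f : Fin β → ℝ := fun j => (1 + ε) ^ (b / 2) * ((1 + ε * u j) ^ b)⁻¹ with hf
  have B : ∀ j k, |phi ε (u k) - phi ε (u j)| ^ b = (f k * f j) * |u k - u j| ^ b := by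
    intro j k
    have h1 : phi ε (u k) - phi ε (u j)
        = (1 + ε) * (u k - u j) / ((1 + ε * u k) * (1 + ε * u j)) := by
      unfold phi
      have := (hD j).ne'
      have := (hD k).ne'
      field_simp
      ring
    have h2 : (1 + ε) ^ b = (1 + ε) ^ (b / 2) * (1 + ε) ^ (b / 2) := by
      rw [← Real.rpow_add hs]; ring_nf
    rw [h1, abs_div, abs_mul, abs_mul, abs_of_pos hs, abs_of_pos (hD k), abs_of_pos (hD j),
      Real.div_rpow (by positivity) (mul_pos (hD k) (hD j)).le, Real.mul_rpow hs.le (abs_nonneg _),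
      Real.mul_rpow (hD k).le (hD j).le, h2]
    simp only [hf]
    rw [div_eq_mul_inv, mul_inv]
    ring
  unfold selbergW
  simp_rw [← ha, ← hb, A, B, Finset.prod_mul_distrib]
  have P := pair_prod β f
  simp_rw [Finset.prod_mul_distrib] at P
  rw [P]
  have Q : (∏ j, (1 + ε) / (1 + ε * u j) ^ 2) *
      (∏ j : Fin β, ((1 + ε) ^ a * ((1 + ε * u j) ^ a)⁻¹ * ((1 + ε * u j) ^ a)⁻¹)) *
      (∏ j, f j ^ (β - 1)) = (1 + ε) ^ (2 * β) * ∏ j, ((1 + ε * u j) ^ 4)⁻¹ := by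
    have c : (1 + ε) ^ (2 * β) = ∏ j : Fin β, (1 + ε) ^ 2 := by
      rw [Finset.prod_const, Finset.card_univ, Fintype.card_fin, pow_mul]
    rw [c, ← Finset.prod_mul_distrib, ← Finset.prod_mul_distrib, ← Finset.prod_mul_distrib]
    refine Finset.prod_congr rfl fun j _ => ?_
    have hcast : ((β - 1 : ℕ) : ℝ) = β - 1 := by
      push_cast [Nat.one_le_iff_ne_zero.mpr hβ.ne']; ring
    have e1 : (1 + ε) * (1 + ε) ^ a * ((1 + ε) ^ (b / 2)) ^ (β - 1) = (1 + ε) ^ 2 := by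
      rw [← Real.rpow_natCast ((1 + ε) ^ (b / 2)), ← Real.rpow_mul hs.le, hcast,
        ← Real.rpow_one_add' hs.le (by rw [ha]; ring_nf; positivity), ← Real.rpow_add hs,
        ← Real.rpow_natCast (1 + ε) 2]
      congr 1
      rw [ha, hb]
      push_cast
      field_simp
      ring
    have e2 : (1 + ε * u j) ^ 2 * ((1 + ε * u j) ^ a * (1 + ε * u j) ^ a)
        * ((1 + ε * u j) ^ b) ^ (β - 1) = (1 + ε * u j) ^ 4 := by
      rw [← Real.rpow_natCast ((1 + ε * u j) ^ b), ← Real.rpow_mul (hD j).le, hcast,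
        ← Real.rpow_natCast (1 + ε * u j) 2, ← Real.rpow_natCast (1 + ε * u j) 4,
        ← Real.rpow_add (hD j), ← Real.rpow_add (hD j), ← Real.rpow_add (hD j)]
      congr 1
      rw [ha, hb]
      push_cast
      field_simp
      ring
    rw [← e1, ← e2]
    simp only [hf]
    rw [mul_pow, inv_pow, mul_inv, mul_inv, mul_inv]
    ring
  simp_rw [Finset.prod_mul_distrib] at Q ⊢
  rw [← Q]
  ring

lemma phi_mem (ε : ℝ) (hε : 0 < ε) (u : ℝ) (hu : u ∈ Set.Icc (0 : ℝ) 1) :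
    phi ε u ∈ Set.Icc (0 : ℝ) 1 := by
  have h := mul_nonneg hε.le hu.1
  unfold phi
  constructor
  · have := hu.1
    positivity
  · rw [div_le_one (by linarith)]
    linarith [hu.2]

lemma cov (β : ℕ) (ε : ℝ) (hε : 0 < ε) (G : (Fin β → ℝ) → ℂ) :
    ∫ u in cube β, G u = ∫ u in cube β, ((∏ j, (1 + ε) / (1 + ε * u j) ^ 2 : ℝ) : ℂ)
      * G (fun j => phi ε (u j)) := by
  have hcm : MeasurableSet (cube β) := MeasurableSet.univ_pi fun _ => measurableSet_Icc
  have hs : 0 < 1 + ε := by linarith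
  have hD : ∀ v ∈ Set.Icc (0 : ℝ) 1, 0 < 1 + ε * v := fun v hv => by
    have := mul_nonneg hε.le hv.1
    linarith
  have hmem : ∀ u ∈ cube β, ∀ j, u j ∈ Set.Icc (0 : ℝ) 1 := fun u hu j => hu j (Set.mem_univ j)
  have himg : (fun (u : Fin β → ℝ) j => phi ε (u j)) '' cube β = cube β := by
    ext v
    constructor
    · rintro ⟨u, hu, rfl⟩ j _
      exact phi_mem ε hε _ (hmem u hu j)
    · intro hv
      have hpos : ∀ j, 0 < 1 + ε - ε * v j := fun j => by
        have := mul_le_mul_of_nonneg_left (hmem v hv j).2 hε.le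
        linarith
      refine ⟨fun j => v j / (1 + ε - ε * v j), fun j _ => ⟨?_, ?_⟩, ?_⟩
      · exact div_nonneg (hmem v hv j).1 (hpos j).le
      · show v j / (1 + ε - ε * v j) ≤ 1
        rw [div_le_one (hpos j)]
        nlinarith [(hmem v hv j).2]
      · funext j
        have h1 := (hpos j).ne'
        have h2 : 1 + ε * (v j / (1 + ε - ε * v j)) = (1 + ε) / (1 + ε - ε * v j) := by
          field_simp
          ring
        simp only [phi]
        rw [h2]
        have := hs.ne'
        field_simp
  have hinj : Set.InjOn (fun (u : Fin β → ℝ) j => phi ε (u j)) (cube β) := by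
    intro u hu v hv huv
    funext j
    have h := congrFun huv j
    have h1 := hD _ (hmem u hu j)
    have h2 := hD _ (hmem v hv j)
    simp only [phi] at h
    rw [div_eq_div_iff h1.ne' h2.ne'] at h
    have : (1 + ε) * (u j - v j) = 0 := by linarith
    rcases mul_eq_zero.mp this with h | h
    · linarith
    · linarith
  have hder : ∀ u ∈ cube β, HasFDerivWithinAt (fun (u : Fin β → ℝ) j => phi ε (u j))
      (ContinuousLinearMap.pi fun j => (((1 + ε) / (1 + ε * u j) ^ 2) •
        ContinuousLinearMap.id ℝ ℝ).comp (ContinuousLinearMap.proj j)) (cube β) u := by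
    intro u hu
    refine HasFDerivAt.hasFDerivWithinAt ?_
    rw [hasFDerivAt_pi]
    intro j
    have h1 := (hD _ (hmem u hu j)).ne'
    have d : HasDerivAt (phi ε) ((1 + ε) / (1 + ε * u j) ^ 2) (u j) := by
      have d1 := (hasDerivAt_id (u j)).const_mul (1 + ε)
      have d2 := ((hasDerivAt_id (u j)).const_mul ε).const_add 1
      refine (d1.div d2 h1).congr_deriv ?_
      simp
      ring
    have d' := d.hasFDerivAt.comp u (ContinuousLinearMap.proj (R := ℝ) (φ := fun _ : Fin β => ℝ) j).hasFDerivAt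
    refine d'.congr_fderiv ?_
    ext v
    simp [mul_comm]
  have key := integral_image_eq_integral_abs_det_fderiv_smul volume hcm hder hinj G
  rw [himg] at key
  rw [key]
  refine setIntegral_congr_fun hcm fun u hu => ?_
  rw [ContinuousLinearMap.det_pi]
  have hp : ∀ j, (((1 + ε) / (1 + ε * u j) ^ 2) • ContinuousLinearMap.id ℝ ℝ).det
      = (1 + ε) / (1 + ε * u j) ^ 2 := by
    intro j
    simp [ContinuousLinearMap.det]
  simp_rw [hp]
  rw [abs_of_nonneg, Complex.real_smul]
  exact Finset.prod_nonneg fun j _ => by positivity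

lemma Ilim_eq (β : ℕ) (x : ℝ) :
    Ilim β x = ∫ u in cube β, (∏ j, bI (2 * π * x) (u j)) * (selbergW β u : ℂ) := by
  unfold Ilim bI
  congr 1
  ext u
  congr 1
  refine Finset.prod_congr rfl fun j _ => ?_
  congr 1
  push_cast; ring

lemma JN_eq (β N : ℕ) (x : ℝ) :
    JN β N x = ∫ u in cube β, (∏ j, aJ (2 * π * x) N (u j)) * (selbergW β u : ℂ) := by
  unfold JN aJ
  congr 1
  ext u
  congr 1
  refine Finset.prod_congr rfl fun j _ => ?_
  congr 5
  push_cast; ring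

lemma kI_int (β : ℕ) (hβ : 0 < β) (θ : ℝ) (N : ℕ) (hN : 0 < N) :
    ∫ u in cube β, (∏ j, bI θ (u j)) * (selbergW β u : ℂ)
      = (1 + (N : ℂ)⁻¹) ^ (2 * β) *
        ∫ u in cube β, (∏ j, kI θ N (u j)) * (selbergW β u : ℂ) := by
  have hcm : MeasurableSet (cube β) := MeasurableSet.univ_pi fun _ => measurableSet_Icc
  have hN' : (0 : ℝ) < (N : ℝ)⁻¹ := by
    have : (0 : ℝ) < N := by exact_mod_cast hN
    positivity
  rw [cov β _ hN', ← integral_const_mul]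
  refine setIntegral_congr_fun hcm fun u hu => ?_
  have h := congrArg (fun r : ℝ => (r : ℂ)) (selbergW_phi β hβ _ hN' u hu)
  simp only [Complex.ofReal_mul] at h
  have hk : ∀ j, kI θ N (u j) = ((((1 + (N : ℝ)⁻¹ * u j) ^ 4)⁻¹ : ℝ) : ℂ)
      * bI θ (phi (N : ℝ)⁻¹ (u j)) := by
    intro j
    rw [kI, phi, div_eq_inv_mul (u j), one_div]
  simp only [hk, Finset.prod_mul_distrib]
  calc _ = (∏ j, bI θ (phi (N : ℝ)⁻¹ (u j))) *
        (((∏ j, (1 + (N : ℝ)⁻¹) / (1 + (N : ℝ)⁻¹ * u j) ^ 2 : ℝ) : ℂ) *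
          (selbergW β (fun j => phi (N : ℝ)⁻¹ (u j)) : ℂ)) := by ring
    _ = _ := by
        rw [h]
        push_cast
        ring

/-- For β a positive even integer and fixed real `x`, the `1/N` term of `J_N(x)` is
`−2πiβx·I(x)`: that is, `N·(J_N(x) − I(x)) → −2πiβx·I(x)` as `N → ∞`. -/
theorem duality_integral_first_correction (β : ℕ) (hβ : 0 < β) (hβe : Even β) (x : ℝ) :
    Tendsto (fun N : ℕ => (N : ℂ) * (JN β N x - Ilim β x)) atTop
      (𝓝 (-(2 * (π : ℂ) * Complex.I * (β : ℂ) * (x : ℂ)) * Ilim β x)) := by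
  simp_rw [JN_eq, Ilim_eq]
  set θ : ℝ := 2 * π * x with hθ
  have hbm : Measurable (bI θ) := by unfold bI; fun_prop
  have ham : ∀ N, Measurable (aJ θ N) := by intro N; unfold aJ; fun_prop
  have hkm : ∀ N, Measurable (kI θ N) := by
    intro N
    unfold kI
    refine Measurable.mul (by fun_prop) (hbm.comp (by fun_prop))
  have hw := selbergW_int β hβ
  have M1 := master β (selbergW β) hw (aJ θ) (bI θ)
    (fun u => Complex.I * θ / 2 * (-4 * u + Complex.I * θ * (u * (1 - u)))) ham hbm
    (2 * θ ^ 2 + 2 * |θ|) (Eventually.of_forall fun N u hu => aJ_norm θ N u hu)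
    (fun u _ => (bI_norm θ u).le)
    (by
      filter_upwards [eventually_ge_atTop 2,
        tendsto_natCast_atTop_atTop.eventually_ge_atTop |θ|] with N h1 h2 u hu
      exact aJ_bound θ N h1 h2 u hu)
    (fun u _ => aJ_lim θ u)
  have M2 := master β (selbergW β) hw (kI θ) (bI θ)
    (fun u => (-4 * u + Complex.I * θ * (u * (1 - u)))) hkm hbm
    (4 + |θ|) (Eventually.of_forall fun N u hu => kI_norm θ N u hu)
    (fun u _ => (bI_norm θ u).le)
    (by
      filter_upwards [eventually_ge_atTop 1] with N h1 u hu
      exact kI_bound θ N h1 u hu)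
    (fun u _ => kI_lim θ u)
  set I0 := ∫ u in cube β, (∏ j, bI θ (u j)) * (selbergW β u : ℂ) with hI0
  have M3 : Tendsto (fun N : ℕ => (N : ℂ) * ((∫ u in cube β, (∏ j, kI θ N (u j))
      * (selbergW β u : ℂ)) - I0)) atTop (𝓝 (-(2 * β) * I0)) := by
    have d : HasDerivAt (fun ε : ℂ => ((1 + ε) ^ (2 * β))⁻¹ * I0) (-(2 * β) * I0) 0 := by
      have d1 := ((((hasDerivAt_id (0 : ℂ)).const_add 1).pow (2 * β)).inv (by simp)).mul_const I0
      refine d1.congr_deriv ?_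
      simp
    have hz : Tendsto (fun N : ℕ => (N : ℂ) * (N : ℂ)⁻¹) atTop (𝓝 1) := by
      refine tendsto_const_nhds.congr' ?_
      filter_upwards [eventually_gt_atTop 0] with N hN
      have hNc : (N : ℂ) ≠ 0 := by exact_mod_cast hN.ne'
      field_simp
    have := lim_of_hasDerivAt d natC_atTop hz
    rw [mul_one] at this
    refine this.congr' ?_
    filter_upwards [eventually_gt_atTop 0] with N hN
    have hne : (1 + (N : ℂ)⁻¹) ^ (2 * β) ≠ 0 := by
      refine pow_ne_zero _ ?_
      have : (0 : ℝ) < 1 + (N : ℝ)⁻¹ := by positivity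
      have h2 : ((1 + (N : ℝ)⁻¹ : ℝ) : ℂ) ≠ 0 := Complex.ofReal_ne_zero.mpr this.ne'
      push_cast at h2
      exact h2
    have hk := kI_int β hβ θ N hN
    rw [← hI0] at hk
    have hk' : ((1 + (N : ℂ)⁻¹) ^ (2 * β))⁻¹ * I0
        = ∫ u in cube β, (∏ j, kI θ N (u j)) * (selbergW β u : ℂ) := by
      rw [hk, inv_mul_cancel_left₀ hne]
    simp [hk']
  have hEq := tendsto_nhds_unique M2 M3
  convert M1 using 2
  have e : ∫ u in cube β, ((∏ j, bI θ (u j)) *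
      ∑ j, (Complex.I * θ / 2 * (-4 * (u j : ℂ) + Complex.I * θ * (u j * (1 - u j)))))
        * (selbergW β u : ℂ)
      = Complex.I * θ / 2 * ∫ u in cube β, ((∏ j, bI θ (u j)) *
      ∑ j, (-4 * (u j : ℂ) + Complex.I * θ * (u j * (1 - u j)))) * (selbergW β u : ℂ) := by
    rw [← integral_const_mul]
    congr 1
    ext u
    rw [← Finset.mul_sum]
    ring
  rw [e, hEq, hθ]
  push_cast
  ring
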